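/- For every finite simple matroid M of rank r+1, the sequence (a₀, a₁, …, a_r) of ranks a_k := rank_ℤ(A^k) of the graded components of the Chow ring is symmetric and unimodal: a_k = a_{r−k} for all 0 ≤ k ≤ r, and a₀ ≤ a₁ ≤ ⋯ ≤ a_{⌊r/2⌋} = a_{⌈r/2⌉} ≥ ⋯ ≥ a_{r−1} ≥ a_r. -/

import Mathlib

open Finset

/-- A finite simple matroid, presented by its lattice of flats and rank function. -/
structure SimpleFlatMatroid (E : Type*) [Fintype E] [DecidableEq E] where
  /-- the collection of flats -/
  flats : Finset (Finset E)
  /-- the rank function -/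
  rk : Finset E → ℕ
  /-- (F1): the ground set is a flat -/
  ground_mem : (Finset.univ : Finset E) ∈ flats
  /-- (F2): flats are closed under intersection -/
  inter_mem : ∀ F ∈ flats, ∀ F' ∈ flats, F ∩ F' ∈ flats
  /-- (F3): for a flat `F` and `i ∉ F` there is a unique flat containing `i` covering `F` -/
  cover_axiom : ∀ F ∈ flats, ∀ i : E, i ∉ F →
    ∃! F' : Finset E, F' ∈ flats ∧ i ∈ F' ∧ F ⊂ F' ∧
      ¬ ∃ F'' ∈ flats, F ⊂ F'' ∧ F'' ⊂ F'
  /-- simplicity: no loops, i.e. `∅` is a flat -/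
  empty_mem : (∅ : Finset E) ∈ flats
  /-- simplicity: no parallel elements, i.e. all singletons are flats -/
  singleton_mem : ∀ i : E, ({i} : Finset E) ∈ flats
  /-- normalization of the rank function -/
  rk_empty : rk ∅ = 0
  /-- the rank function increases by one along covers of flats -/
  rk_cover : ∀ F ∈ flats, ∀ F' ∈ flats, F ⊂ F' →
    (¬ ∃ F'' ∈ flats, F ⊂ F'' ∧ F'' ⊂ F') → rk F' = rk F + 1

namespace SimpleFlatMatroid

variable {E : Type*} [Fintype E] [DecidableEq E]

/-- We encode a (squarefree-or-not) monomial in the variables `x_F` as the function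
sending each `F` to the exponent of `x_F`.  `prevFlat m F` is the union of all flats
in the support of `m` strictly contained in `F`; when the support of `m` is a chain
this is the predecessor of `F` in the support (or `∅` if there is none). -/
def prevFlat (m : Finset E → ℕ) (F : Finset E) : Finset E :=
  Finset.univ.sup fun F' => if m F' ≠ 0 ∧ F' ⊂ F then F' else ∅

/-- The total degree of a monomial. -/
def deg (m : Finset E → ℕ) : ℕ := ∑ F : Finset E, m F

variable (M : SimpleFlatMatroid E)

/-- `m` is an FY-monomial: its support is a chain `F₁ ⊊ ⋯ ⊊ F_ℓ` of nonempty flats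
with `m Fᵢ ≤ rk(Fᵢ) - rk(Fᵢ₋₁) - 1` for all `i` (with `F₀ := ∅`). -/
def IsFY (m : Finset E → ℕ) : Prop :=
  (∀ F : Finset E, m F ≠ 0 → F ∈ M.flats ∧ F ≠ ∅) ∧
  (∀ F F' : Finset E, m F ≠ 0 → m F' ≠ 0 → F ⊆ F' ∨ F' ⊆ F) ∧
  (∀ F : Finset E, m F ≠ 0 → m F + M.rk (prevFlat m F) + 1 ≤ M.rk F)

/-- The set `FY^k` of FY-monomials of total degree `k`, as a type. -/
abbrev FYk (k : ℕ) : Type _ := {m : Finset E → ℕ // M.IsFY m ∧ deg m = k}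

/-- `g` is an automorphism of the matroid: a permutation of the ground set carrying
flats to flats. -/
def IsAut (g : Equiv.Perm E) : Prop := ∀ F ∈ M.flats, F.image g ∈ M.flats

/-- The action of a permutation `g` on monomials:
`g ⋅ (x_{F₁}^{m₁} ⋯ x_{F_ℓ}^{m_ℓ}) = x_{g F₁}^{m₁} ⋯ x_{g F_ℓ}^{m_ℓ}`. -/
def mact (g : Equiv.Perm E) (m : Finset E → ℕ) : Finset E → ℕ :=
  fun F => m (F.image (g⁻¹ : Equiv.Perm E))

end SimpleFlatMatroid

namespace SimpleFlatMatroid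

variable {E : Type*} [Fintype E] [DecidableEq E] (M : SimpleFlatMatroid E)

/-- The index type of the variables of the Chow ring: nonempty flats of `M`. -/
abbrev FlatVar : Type _ := {F : Finset E // F ∈ M.flats ∧ F ≠ ∅}

/-- The polynomial ring `S = ℤ[x_F : ∅ ≠ F ∈ 𝓕]`. -/
abbrev ChowPoly : Type _ := MvPolynomial (FlatVar M) ℤ

/-- The ideal `I + J`, where `I` is generated by the products `x_F x_{F'}` over
incomparable pairs of nonempty flats, and `J` is generated by the linear forms
`∑_{F ∋ a} x_F`, one for each element `a` of the ground set. -/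
noncomputable def chowIdeal : Ideal (ChowPoly M) :=
  Ideal.span
    ({p | ∃ F F' : FlatVar M, ¬ F.1 ⊆ F'.1 ∧ ¬ F'.1 ⊆ F.1 ∧
        p = MvPolynomial.X F * MvPolynomial.X F'} ∪
     {p | ∃ a : E, p = ∑ F : FlatVar M, if a ∈ F.1 then MvPolynomial.X F else 0})

/-- The Chow ring `A(M) = S/(I+J)`. -/
abbrev ChowRing : Type _ := ChowPoly M ⧸ chowIdeal M

/-- The quotient map `S → A(M)`. -/
noncomputable def chowMk : ChowPoly M →ₐ[ℤ] ChowRing M :=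
  Ideal.Quotient.mkₐ ℤ (chowIdeal M)

/-- The degree-`k` graded component `A^k` of the Chow ring, i.e. the image of the
homogeneous degree-`k` polynomials under the quotient map. -/
noncomputable def chowComp (k : ℕ) : Submodule ℤ (ChowRing M) :=
  (MvPolynomial.homogeneousSubmodule (FlatVar M) ℤ k).map (chowMk M).toLinearMap

/-- The polynomial `x_{F₁}^{m₁} ⋯ x_{F_ℓ}^{m_ℓ}` in `S` corresponding to a monomial
given as an exponent function on flats. -/
noncomputable def FYpoly (m : Finset E → ℕ) : ChowPoly M :=
  MvPolynomial.monomial (Finsupp.equivFunOnFinite.symm fun F : FlatVar M => m F.1) 1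

/-- The action of an automorphism `g` on the polynomial ring `S`, by `x_F ↦ x_{g F}`. -/
noncomputable def autRename (g : Equiv.Perm E) (hg : M.IsAut g) :
    ChowPoly M →ₐ[ℤ] ChowPoly M :=
  MvPolynomial.rename fun F : FlatVar M =>
    (⟨F.1.image g, hg F.1 F.2.1, by
        simpa [Finset.image_eq_empty] using F.2.2⟩ : FlatVar M)

/-- The class in `A^k` of a homogeneous polynomial of degree `k`. -/
noncomputable def clsOf {k : ℕ} (p : ChowPoly M)
    (hp : p ∈ MvPolynomial.homogeneousSubmodule (FlatVar M) ℤ k) : chowComp M k :=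
  ⟨chowMk M p, Submodule.mem_map_of_mem hp⟩


/-- The variable `x_E` corresponding to the ground set. -/
noncomputable def xE [Nonempty E] : ChowPoly M :=
  MvPolynomial.X (⟨Finset.univ, M.ground_mem, Finset.univ_nonempty.ne_empty⟩ : FlatVar M)


/-- Renaming variables along an automorphism preserves homogeneity. -/
theorem autRename_mem_homogeneousSubmodule {k : ℕ} (g : Equiv.Perm E) (hg : M.IsAut g)
    {p : ChowPoly M} (hp : p ∈ MvPolynomial.homogeneousSubmodule (FlatVar M) ℤ k) :
    autRename M g hg p ∈ MvPolynomial.homogeneousSubmodule (FlatVar M) ℤ k := by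
  rw [MvPolynomial.mem_homogeneousSubmodule] at hp ⊢
  exact hp.rename_isHomogeneous

end SimpleFlatMatroid

namespace SimpleFlatMatroid

section rank

variable {E : Type*} [Fintype E] [DecidableEq E] (M : SimpleFlatMatroid E)

/-- closure of a set -/
def cl (X : Finset E) : Finset E := (M.flats.filter (fun F => X ⊆ F)).inf id

lemma cl_mem (X : Finset E) : M.cl X ∈ M.flats := by
  unfold cl
  apply Finset.inf_induction (p := fun Y => Y ∈ M.flats)
  · exact M.ground_mem
  · intro a ha b hb
    exact M.inter_mem a ha b hb
  · intro b hb
    exact (Finset.mem_filter.1 hb).1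

lemma subset_cl (X : Finset E) : X ⊆ M.cl X := by
  unfold cl
  apply Finset.le_inf
  intro b hb
  exact (Finset.mem_filter.1 hb).2

lemma cl_subset {X F : Finset E} (hF : F ∈ M.flats) (h : X ⊆ F) : M.cl X ⊆ F :=
  Finset.inf_le (f := id) (Finset.mem_filter.2 ⟨hF, h⟩)

lemma cl_flat {F : Finset E} (hF : F ∈ M.flats) : M.cl F = F :=
  Finset.Subset.antisymm (M.cl_subset hF (Finset.Subset.refl _)) (M.subset_cl F)

lemma cl_mono {X Y : Finset E} (h : X ⊆ Y) : M.cl X ⊆ M.cl Y :=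
  M.cl_subset (M.cl_mem Y) (h.trans (M.subset_cl Y))

lemma exists_between {G H : Finset E} (hG : G ∈ M.flats) (hH : H ∈ M.flats) (h : G ⊂ H) :
    ∃ H' ∈ M.flats, G ⊆ H' ∧ H' ⊂ H ∧ M.rk H = M.rk H' + 1 := by
  obtain ⟨H', h1, h2⟩ := Finset.exists_max_image
    (M.flats.filter (fun F => G ⊆ F ∧ F ⊂ H)) Finset.card
    ⟨G, Finset.mem_filter.2 ⟨hG, Finset.Subset.refl _, h⟩⟩
  obtain ⟨a, b, c⟩ := Finset.mem_filter.1 h1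
  refine ⟨H', a, b, c, M.rk_cover H' a H hH c ?_⟩
  rintro ⟨F'', e, f, g⟩
  have := h2 F'' (Finset.mem_filter.2 ⟨e, b.trans f.subset, g⟩)
  have := Finset.card_lt_card f
  omega

lemma rk_lt {G H : Finset E} (hG : G ∈ M.flats) (hH : H ∈ M.flats) (h : G ⊂ H) :
    M.rk G < M.rk H := by
  induction hn : H.card using Nat.strong_induction_on generalizing H with
  | _ n ih =>
    obtain ⟨H', a, b, c, d⟩ := M.exists_between hG hH h
    rcases b.eq_or_ssubset with rfl | b
    · omega
    · have := ih H'.card (hn ▸ Finset.card_lt_card c) a b rfl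
      omega

lemma rk_le {G H : Finset E} (hG : G ∈ M.flats) (hH : H ∈ M.flats) (h : G ⊆ H) :
    M.rk G ≤ M.rk H := by
  rcases h.eq_or_ssubset with rfl | h
  · rfl
  · exact (M.rk_lt hG hH h).le

/-- rank of an arbitrary set -/
def rho (X : Finset E) : ℕ := M.rk (M.cl X)

lemma rho_flat {F : Finset E} (hF : F ∈ M.flats) : M.rho F = M.rk F := by
  rw [rho, M.cl_flat hF]

lemma rho_mono {X Y : Finset E} (h : X ⊆ Y) : M.rho X ≤ M.rho Y :=
  M.rk_le (M.cl_mem _) (M.cl_mem _) (M.cl_mono h)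

lemma rho_insert_of_mem {X : Finset E} {i : E} (h : i ∈ M.cl X) :
    M.rho (insert i X) = M.rho X := by
  apply le_antisymm
  · apply M.rk_le (M.cl_mem _) (M.cl_mem _)
    apply M.cl_subset (M.cl_mem _)
    exact Finset.insert_subset h (M.subset_cl X)
  · exact M.rho_mono (Finset.subset_insert _ _)

lemma rho_insert_of_notMem {X : Finset E} {i : E} (h : i ∉ M.cl X) :
    M.rho (insert i X) = M.rho X + 1 := by
  obtain ⟨F', ⟨h1, h2, h3, h4⟩, -⟩ := cover_axiom M _ (M.cl_mem X) i h
  have h5 : M.cl (insert i X) ⊆ F' :=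
    M.cl_subset h1 (Finset.insert_subset h2 ((M.subset_cl X).trans h3.subset))
  have h6 : M.cl X ⊂ M.cl (insert i X) := by
    refine Finset.ssubset_iff_subset_ne.2 ⟨M.cl_mono (Finset.subset_insert _ _), ?_⟩
    intro e
    apply h
    rw [e]
    exact M.subset_cl _ (Finset.mem_insert_self _ _)
  have h7 : M.cl (insert i X) = F' := by
    rcases h5.eq_or_ssubset with e | e
    · exact e
    · exact (h4 ⟨_, M.cl_mem _, h6, e⟩).elim
  rw [rho, h7, rho]
  exact M.rk_cover _ (M.cl_mem _) _ h1 h3 h4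

lemma rho_dim {X Y : Finset E} (Z : Finset E) (h : X ⊆ Y) :
    M.rho (Y ∪ Z) + M.rho X ≤ M.rho (X ∪ Z) + M.rho Y := by
  induction Z using Finset.induction_on with
  | empty => simp only [Finset.union_empty]; omega
  | insert i Z _ ih =>
    rw [Finset.union_insert, Finset.union_insert]
    by_cases hi : i ∈ M.cl (X ∪ Z)
    · rw [M.rho_insert_of_mem hi,
        M.rho_insert_of_mem (M.cl_mono (Finset.union_subset_union_left h) hi)]
      exact ih
    · rw [M.rho_insert_of_notMem hi]
      by_cases hj : i ∈ M.cl (Y ∪ Z)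
      · rw [M.rho_insert_of_mem hj]; omega
      · rw [M.rho_insert_of_notMem hj]; omega

lemma rho_submod (U V W : Finset E) (hU : W ⊆ U) (hV : W ⊆ V) :
    M.rho (U ∪ V) + M.rho W ≤ M.rho U + M.rho V := by
  have := M.rho_dim V hU
  rw [Finset.union_eq_right.2 hV] at this
  omega

lemma rho_union_cl (X Y : Finset E) : M.rho (X ∪ M.cl Y) = M.rho (X ∪ Y) := by
  apply le_antisymm
  · apply M.rk_le (M.cl_mem _) (M.cl_mem _)
    apply M.cl_subset (M.cl_mem _)
    apply Finset.union_subset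
    · exact Finset.subset_union_left.trans (M.subset_cl _)
    · exact M.cl_mono Finset.subset_union_right
  · exact M.rho_mono (Finset.union_subset_union_right (M.subset_cl Y))

lemma rk_singleton (a : E) : M.rk {a} = 1 := by
  have h := M.rho_insert_of_notMem (X := ∅) (i := a) (by
    rw [M.cl_flat M.empty_mem]; simp)
  rw [M.rho_flat M.empty_mem, M.rk_empty] at h
  have h2 : insert a (∅ : Finset E) = {a} := by simp
  rw [h2, M.rho_flat (M.singleton_mem a)] at h
  exact h

/-- join of two nonempty flats -/
def join (F G : FlatVar M) : FlatVar M :=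
  ⟨M.cl (F.1 ∪ G.1), M.cl_mem _, by
    obtain ⟨a, ha⟩ := Finset.nonempty_iff_ne_empty.2 F.2.2
    exact Finset.ne_empty_of_mem (M.subset_cl _ (Finset.mem_union_left _ ha))⟩

lemma join_comm (F G : FlatVar M) : M.join F G = M.join G F := by
  apply Subtype.ext
  simp [join, Finset.union_comm]

lemma left_le_join (F G : FlatVar M) : F.1 ⊆ (M.join F G).1 :=
  Finset.subset_union_left.trans (M.subset_cl _)

lemma right_le_join (F G : FlatVar M) : G.1 ⊆ (M.join F G).1 :=
  Finset.subset_union_right.trans (M.subset_cl _)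

lemma join_le {F G H : FlatVar M} (h1 : F.1 ⊆ H.1) (h2 : G.1 ⊆ H.1) : (M.join F G).1 ⊆ H.1 :=
  M.cl_subset H.2.1 (Finset.union_subset h1 h2)

/-- atom -/
def atom (a : E) : FlatVar M := ⟨{a}, M.singleton_mem a, by simp⟩

end rank

end SimpleFlatMatroid

namespace SimpleFlatMatroid

section ring

variable {E : Type*} [Fintype E] [DecidableEq E] (M : SimpleFlatMatroid E)

lemma up_induction {P : FlatVar M → Prop}
    (h : ∀ F, (∀ G : FlatVar M, F.1 ⊂ G.1 → P G) → P F) (F : FlatVar M) : P F := by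
  induction hn : Fintype.card E - F.1.card using Nat.strong_induction_on generalizing F with
  | _ n ih =>
    apply h
    intro G hG
    have h1 := Finset.card_lt_card hG
    have h2 := Finset.card_le_univ G.1
    exact ih _ (by omega) G rfl

/-- sum of `f` over all flats above `F` -/
def upSum {A : Type*} [AddCommMonoid A] (f : FlatVar M → A) (F : FlatVar M) : A :=
  ∑ G ∈ Finset.univ.filter (fun G : FlatVar M => F.1 ⊆ G.1), f G

lemma upSum_eq {A : Type*} [AddCommMonoid A] (f : FlatVar M → A) (F : FlatVar M) :
    M.upSum f F = f F + ∑ G ∈ Finset.univ.filter (fun G : FlatVar M => F.1 ⊂ G.1), f G := by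
  unfold upSum
  rw [← Finset.add_sum_erase _ f (Finset.mem_filter.2 ⟨Finset.mem_univ F, Finset.Subset.refl _⟩)]
  congr 1
  apply Finset.sum_congr _ (fun _ _ => rfl)
  ext G
  simp only [Finset.mem_erase, Finset.mem_filter, Finset.mem_univ, true_and,
    Finset.ssubset_iff_subset_ne]
  constructor
  · rintro ⟨h1, h2⟩
    exact ⟨h2, fun e => h1 (Subtype.ext e.symm)⟩
  · rintro ⟨h1, h2⟩
    exact ⟨fun e => h2 (by rw [e]), h1⟩

lemma upSum_inj {A : Type*} [AddCommGroup A] {f g : FlatVar M → A}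
    (h : ∀ F, M.upSum f F = M.upSum g F) (F : FlatVar M) : f F = g F := by
  induction F using up_induction with
  | h F ih =>
    have h1 := h F
    rw [upSum_eq, upSum_eq] at h1
    rw [Finset.sum_congr rfl (fun G hG => ih G (Finset.mem_filter.1 hG).2)] at h1
    exact add_right_cancel h1

lemma upSum_sub_join {A : Type*} [AddCommGroup A] (f : FlatVar M → A) (F G : FlatVar M) :
    M.upSum f F - M.upSum f (M.join F G) =
      ∑ H ∈ Finset.univ.filter (fun H : FlatVar M => F.1 ⊆ H.1 ∧ ¬ G.1 ⊆ H.1), f H := by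
  rw [sub_eq_iff_eq_add]
  unfold upSum
  rw [← Finset.sum_filter_add_sum_filter_not (Finset.univ.filter
    (fun H : FlatVar M => F.1 ⊆ H.1)) (fun H => ¬ G.1 ⊆ H.1), Finset.filter_filter,
    Finset.filter_filter]
  congr 1
  apply Finset.sum_congr _ (fun _ _ => rfl)
  ext H
  simp only [Finset.mem_filter, Finset.mem_univ, true_and, not_not]
  constructor
  · rintro ⟨h1, h2⟩
    exact M.join_le h1 h2
  · intro h
    exact ⟨(M.left_le_join F G).trans h, (M.right_le_join F G).trans h⟩

/-- The inverse change of variables. -/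
noncomputable def psiX (F : FlatVar M) : ChowPoly M :=
  MvPolynomial.X F -
    ∑ G : {G : FlatVar M // F.1 ⊂ G.1}, psiX G.1
termination_by Fintype.card E - F.1.card
decreasing_by
  have h1 := Finset.card_lt_card G.2
  have h2 := Finset.card_le_univ G.1.1
  omega

lemma upSum_psiX (F : FlatVar M) : M.upSum M.psiX F = MvPolynomial.X F := by
  rw [upSum_eq, psiX, sub_add_eq_add_sub, add_sub_assoc, add_eq_left, sub_eq_zero]
  exact Finset.sum_subtype _ (by simp) _

lemma psiX_hom (F : FlatVar M) : (M.psiX F).IsHomogeneous 1 := by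
  induction F using up_induction with
  | h F ih =>
    rw [psiX]
    apply (MvPolynomial.isHomogeneous_X _ _).sub
    apply MvPolynomial.IsHomogeneous.sum
    intro G _
    exact ih G.1 G.2

/-- inverse change of variables, on polynomials -/
noncomputable def psi : ChowPoly M →ₐ[ℤ] ChowPoly M := MvPolynomial.aeval M.psiX

/-- simplicial generators -/
noncomputable def hX (F : FlatVar M) : ChowPoly M := M.upSum MvPolynomial.X F

lemma hX_hom (F : FlatVar M) : (M.hX F).IsHomogeneous 1 := by
  apply MvPolynomial.IsHomogeneous.sum
  intro G _
  exact MvPolynomial.isHomogeneous_X _ _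

/-- change of variables -/
noncomputable def phi : ChowPoly M →ₐ[ℤ] ChowPoly M := MvPolynomial.aeval M.hX

lemma psi_phi (p : ChowPoly M) : M.psi (M.phi p) = p := by
  have : (M.psi.comp M.phi) = AlgHom.id ℤ _ := by
    apply MvPolynomial.algHom_ext
    intro F
    simp only [AlgHom.comp_apply, phi, psi, hX, upSum, MvPolynomial.aeval_X, map_sum,
      AlgHom.id_apply]
    exact M.upSum_psiX F
  exact DFunLike.congr_fun this p

lemma phi_psi (p : ChowPoly M) : M.phi (M.psi p) = p := by
  have : (M.phi.comp M.psi) = AlgHom.id ℤ _ := by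
    apply MvPolynomial.algHom_ext
    apply M.upSum_inj
    intro F
    have h := congrArg M.phi (M.upSum_psiX F)
    simp only [upSum, map_sum] at h
    simp only [upSum, AlgHom.comp_apply, psi, MvPolynomial.aeval_X, h, AlgHom.id_apply]
    rw [phi, MvPolynomial.aeval_X]
    rfl
  exact DFunLike.congr_fun this p

/-- The ideal in the simplicial variables. -/
noncomputable def KT : Ideal (ChowPoly M) :=
  Ideal.span ({p | ∃ a : E, p = MvPolynomial.X (M.atom a)} ∪
    {p | ∃ F G : FlatVar M, p = (MvPolynomial.X F - MvPolynomial.X (M.join F G)) *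
      (MvPolynomial.X G - MvPolynomial.X (M.join F G))})

lemma psiX_mul_mem (F G : FlatVar M) (h1 : ¬ F.1 ⊆ G.1) (h2 : ¬ G.1 ⊆ F.1) :
    M.psiX F * M.psiX G ∈ M.KT := by
  induction hn : (Fintype.card E - F.1.card) + (Fintype.card E - G.1.card)
    using Nat.strong_induction_on generalizing F G with
  | _ n ih =>
    have key : (MvPolynomial.X F - MvPolynomial.X (M.join F G)) *
      (MvPolynomial.X G - MvPolynomial.X (M.join F G)) ∈ M.KT :=
      Ideal.subset_span (Or.inr ⟨F, G, rfl⟩)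
    rw [← M.upSum_psiX F, ← M.upSum_psiX G, ← M.upSum_psiX (M.join F G), upSum_sub_join,
      M.join_comm F G, upSum_sub_join, Finset.sum_mul_sum, ← Finset.sum_product',
      ← Finset.add_sum_erase _ _ (a := (F, G))
      (by simp only [Finset.mem_product, Finset.mem_filter, Finset.mem_univ, true_and,
            Finset.Subset.refl]; exact ⟨h2, h1⟩)] at key
    refine (Ideal.add_mem_iff_left _ ?_).1 key
    apply Ideal.sum_mem
    rintro ⟨H, H'⟩ hH
    simp only [Finset.mem_erase, Finset.mem_product, Finset.mem_filter, Finset.mem_univ,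
      true_and, ne_eq, Prod.mk.injEq] at hH
    obtain ⟨h3, ⟨h4, h5⟩, h6, h7⟩ := hH
    have c1 := Finset.card_le_univ H.1
    have c2 := Finset.card_le_univ H'.1
    have c3 := Finset.card_le_card h4
    have c4 := Finset.card_le_card h6
    have c5 : ¬ (F.1.card = H.1.card ∧ G.1.card = H'.1.card) := by
      rintro ⟨e1, e2⟩
      apply h3
      exact ⟨Subtype.ext (Finset.eq_of_subset_of_card_le h4 e1.ge).symm,
        Subtype.ext (Finset.eq_of_subset_of_card_le h6 e2.ge).symm⟩
    exact ih _ (by omega) H H' (fun e => h7 (h4.trans e)) (fun e => h5 (h6.trans e)) rfl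

lemma psi_mem (p : ChowPoly M) (hp : p ∈ M.chowIdeal) : M.psi p ∈ M.KT := by
  suffices M.chowIdeal ≤ M.KT.comap M.psi from this hp
  unfold chowIdeal
  rw [Ideal.span_le]
  rintro p (⟨F, G, h1, h2, rfl⟩ | ⟨a, rfl⟩)
  · simp only [SetLike.mem_coe, Ideal.mem_comap, map_mul, psi, MvPolynomial.aeval_X]
    exact M.psiX_mul_mem F G h1 h2
  · simp only [SetLike.mem_coe, Ideal.mem_comap, map_sum, ← Finset.sum_filter, psi,
      MvPolynomial.aeval_X]
    have := M.upSum_psiX (M.atom a)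
    simp only [upSum, atom, Finset.singleton_subset_iff] at this
    rw [this]
    exact Ideal.subset_span (Or.inl ⟨a, rfl⟩)

/-- simplicial generators in the Chow ring -/
noncomputable def y (F : FlatVar M) : ChowRing M := M.chowMk (M.hX F)

lemma y_eq (F : FlatVar M) : M.y F = M.upSum (fun G => M.chowMk (MvPolynomial.X G)) F := by
  simp [y, hX, upSum]

lemma y_atom (a : E) : M.y (M.atom a) = 0 := by
  rw [y, chowMk, Ideal.Quotient.mkₐ_eq_mk, Ideal.Quotient.eq_zero_iff_mem]
  apply Ideal.subset_span
  right
  refine ⟨a, ?_⟩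
  simp [hX, upSum, atom, Finset.sum_filter]

lemma y_quad (F G : FlatVar M) :
    (M.y F - M.y (M.join F G)) * (M.y G - M.y (M.join F G)) = 0 := by
  rw [y_eq, y_eq, y_eq, upSum_sub_join, M.join_comm F G, upSum_sub_join, Finset.sum_mul_sum]
  apply Finset.sum_eq_zero
  intro H hH
  apply Finset.sum_eq_zero
  intro H' hH'
  simp only [Finset.mem_filter, Finset.mem_univ, true_and] at hH hH'
  rw [← map_mul, chowMk, Ideal.Quotient.mkₐ_eq_mk, Ideal.Quotient.eq_zero_iff_mem]
  apply Ideal.subset_span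
  left
  exact ⟨H, H', fun e => hH'.2 (hH.1.trans e), fun e => hH.2 (hH'.1.trans e), rfl⟩

lemma y_cover (H' H : FlatVar M) (h : H'.1 ⊂ H.1) (hr : M.rk H.1 = M.rk H'.1 + 1) :
    M.y H * M.y H' = M.y H * M.y H := by
  obtain ⟨a, ha, ha'⟩ := Finset.exists_of_ssubset h
  have e : M.join H' (M.atom a) = H := by
    apply Subtype.ext
    have h1 : (M.join H' (M.atom a)).1 ⊆ H.1 :=
      M.join_le h.subset (Finset.singleton_subset_iff.2 ha)
    rcases h1.eq_or_ssubset with h1 | h1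
    · exact h1
    · exfalso
      have h2 := M.rk_lt (M.join H' (M.atom a)).2.1 H.2.1 h1
      have h3 : H'.1 ⊂ (M.join H' (M.atom a)).1 := by
        refine Finset.ssubset_iff_subset_ne.2 ⟨M.left_le_join _ _, ?_⟩
        intro e
        apply ha'
        rw [e]
        exact M.right_le_join H' (M.atom a) (Finset.mem_singleton_self a)
      have h4 := M.rk_lt H'.2.1 (M.join H' (M.atom a)).2.1 h3
      omega
  have := M.y_quad H' (M.atom a)
  rw [e, y_atom] at this
  linear_combination -this

lemma y_cover_pow (H' H : FlatVar M) (h : H'.1 ⊂ H.1) (hr : M.rk H.1 = M.rk H'.1 + 1) (d : ℕ) :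
    M.y H * M.y H' ^ d = M.y H ^ (d + 1) := by
  induction d with
  | zero => simp
  | succ d ih =>
    rw [pow_succ, ← mul_assoc, ih, pow_succ, mul_assoc, M.y_cover H' H h hr]
    ring

lemma y_rel (d : ℕ) (G H : FlatVar M) (h : G.1 ⊆ H.1) (hd : M.rk H.1 = M.rk G.1 + d) :
    M.y G * M.y H ^ d = M.y H ^ (d + 1) := by
  induction d generalizing H with
  | zero =>
    rcases h.eq_or_ssubset with h | h
    · rw [Subtype.ext h]; simp
    · have := M.rk_lt G.2.1 H.2.1 h
      omega
  | succ d ih =>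
    have h' : G.1 ⊂ H.1 := by
      refine Finset.ssubset_iff_subset_ne.2 ⟨h, ?_⟩
      intro e
      rw [e] at hd
      omega
    obtain ⟨H', a, b, c, e⟩ := M.exists_between G.2.1 H.2.1 h'
    have hne : H' ≠ ∅ := by
      rintro rfl
      exact G.2.2 (Finset.subset_empty.1 b)
    have h1 := ih ⟨H', a, hne⟩ b (by simp only; omega)
    have h2 := M.y_cover_pow ⟨H', a, hne⟩ H c e
    rw [← h2 d, mul_left_comm, h1, h2]

lemma y_zero (d : ℕ) (H : FlatVar M) (hd : M.rk H.1 = d) : M.y H ^ d = 0 := by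
  induction d generalizing H with
  | zero =>
    have := M.rk_lt M.empty_mem H.2.1 (Finset.empty_ssubset.2
      (Finset.nonempty_iff_ne_empty.2 H.2.2))
    omega
  | succ d ih =>
    obtain ⟨H', a, b, c, e⟩ := M.exists_between M.empty_mem H.2.1 (Finset.empty_ssubset.2
      (Finset.nonempty_iff_ne_empty.2 H.2.2))
    by_cases hne : H' = ∅
    · subst hne
      rw [M.rk_empty] at e
      have hd0 : d = 0 := by omega
      obtain ⟨x, hx⟩ := Finset.nonempty_iff_ne_empty.2 H.2.2
      have hH : H = M.atom x := by
        apply Subtype.ext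
        have h1 : ({x} : Finset E) ⊆ H.1 := Finset.singleton_subset_iff.2 hx
        rcases h1.eq_or_ssubset with h1 | h1
        · exact h1.symm
        · have := M.rk_lt (M.singleton_mem x) H.2.1 h1
          rw [M.rk_singleton] at this
          omega
      rw [hH, M.y_atom, hd0]
      simp
    · rw [← M.y_cover_pow ⟨H', a, hne⟩ H c e, ih ⟨H', a, hne⟩ (by simp only; omega), mul_zero]

end ring

end SimpleFlatMatroid

namespace SimpleFlatMatroid

section functional

variable {E : Type*} [Fintype E] [DecidableEq E] (M : SimpleFlatMatroid E)

/-- union of the flats in the support -/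
def sp (J : FlatVar M →₀ ℕ) : Finset E := J.support.sup Subtype.val

variable {M}

lemma mem_sp {J : FlatVar M →₀ ℕ} {a : E} : a ∈ sp M J ↔ ∃ G, J G ≠ 0 ∧ a ∈ G.1 := by
  simp [sp, Finset.mem_sup]

lemma sp_add (J J' : FlatVar M →₀ ℕ) : sp M (J + J') = sp M J ∪ sp M J' := by
  ext a
  simp only [mem_sp, Finset.mem_union, Finsupp.add_apply]
  constructor
  · rintro ⟨G, h1, h2⟩
    by_cases h : J G = 0
    · right; exact ⟨G, by omega, h2⟩
    · left; exact ⟨G, h, h2⟩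
  · rintro (⟨G, h1, h2⟩ | ⟨G, h1, h2⟩)
    · exact ⟨G, by omega, h2⟩
    · exact ⟨G, by omega, h2⟩

lemma sp_mono {J J' : FlatVar M →₀ ℕ} (h : J ≤ J') : sp M J ⊆ sp M J' := by
  intro a
  simp only [mem_sp]
  rintro ⟨G, h1, h2⟩
  have := h G
  exact ⟨G, by omega, h2⟩

lemma sp_single (A : FlatVar M) : sp M (Finsupp.single A 1) = A.1 := by
  ext a
  simp only [mem_sp, Finsupp.single_apply]
  constructor
  · rintro ⟨G, h1, h2⟩
    by_cases h : A = G
    · rw [h]; exact h2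
    · simp [h] at h1
  · intro h
    exact ⟨A, by simp, h⟩

lemma sp_zero : sp M (0 : FlatVar M →₀ ℕ) = ∅ := by
  simp [sp]

lemma sp_sup (J J' : FlatVar M →₀ ℕ) : sp M (J ⊔ J') = sp M J ∪ sp M J' := by
  ext a
  simp only [mem_sp, Finset.mem_union, Finsupp.sup_apply]
  constructor
  · rintro ⟨G, h1, h2⟩
    by_cases h : J G = 0
    · right; exact ⟨G, by rw [h] at h1; simpa using h1, h2⟩
    · left; exact ⟨G, h, h2⟩
  · rintro (⟨G, h1, h2⟩ | ⟨G, h1, h2⟩)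
    · exact ⟨G, by have := le_sup_left (a := J G) (b := J' G); omega, h2⟩
    · exact ⟨G, by have := le_sup_right (a := J G) (b := J' G); omega, h2⟩

lemma degree_sup_inf (J J' : FlatVar M →₀ ℕ) :
    (J ⊔ J').degree + (J ⊓ J').degree = J.degree + J'.degree := by
  rw [← map_add, ← map_add]
  congr 1
  ext G
  simp only [Finsupp.add_apply, Finsupp.sup_apply, Finsupp.inf_apply]
  exact max_add_min _ _

lemma le_add_single {J v : FlatVar M →₀ ℕ} {A : FlatVar M} :
    J ≤ v + Finsupp.single A 1 ↔ J ≤ v ∨ ∃ J0, J0 ≤ v ∧ J = J0 + Finsupp.single A 1 := by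
  constructor
  · intro h
    by_cases hA : J A ≤ v A
    · left
      intro G
      by_cases e : A = G
      · rw [← e]; exact hA
      · have := h G
        simpa [e] using this
    · right
      refine ⟨J - Finsupp.single A 1, ?_, ?_⟩
      · rwa [tsub_le_iff_right]
      · rw [tsub_add_cancel_of_le]
        rw [Finsupp.single_le_iff]
        omega
  · rintro (h | ⟨J0, h, rfl⟩)
    · exact h.trans le_self_add
    · exact add_le_add_left h _

variable (M)
variable (π : FlatVar M → FlatVar M) (P : FlatVar M → Finset E)

/-- support is inside a fibre -/
def InFib (p : FlatVar M) (J : FlatVar M →₀ ℕ) : Prop := ∀ G, J G ≠ 0 → π G = p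

/-- the nondegeneracy condition -/
def Nd (v : FlatVar M →₀ ℕ) : Prop := ∀ p, ∀ J ≤ v, J ≠ 0 → M.InFib π p J →
  J.degree + 1 + M.rho (P p) ≤ M.rho (P p ∪ sp M J)

/-- auxiliary condition -/
def Cd (v : FlatVar M →₀ ℕ) (p : FlatVar M) (X : Finset E) (c : ℕ) : Prop :=
  ∀ J ≤ v, M.InFib π p J → J.degree + c + 1 + M.rho (P p) ≤ M.rho (P p ∪ sp M J ∪ X)

variable {M π P}

lemma inFib_add {p : FlatVar M} {J J' : FlatVar M →₀ ℕ} :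
    M.InFib π p (J + J') ↔ M.InFib π p J ∧ M.InFib π p J' := by
  constructor
  · intro h
    exact ⟨fun G hG => h G (by rw [Finsupp.add_apply]; omega),
      fun G hG => h G (by rw [Finsupp.add_apply]; omega)⟩
  · rintro ⟨h1, h2⟩ G hG
    by_cases h : J G = 0
    · apply h2; rw [Finsupp.add_apply] at hG; omega
    · exact h1 G h

lemma inFib_single {p A : FlatVar M} : M.InFib π p (Finsupp.single A 1) ↔ π A = p := by
  constructor
  · intro h
    exact h A (by simp)
  · intro h G hG
    by_cases e : A = G
    · rw [← e]; exact h
    · simp [e] at hG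

lemma nd_add {v : FlatVar M →₀ ℕ} {A : FlatVar M} :
    M.Nd π P (v + Finsupp.single A 1) ↔ M.Nd π P v ∧ M.Cd π P v (π A) A.1 1 := by
  constructor
  · intro h
    refine ⟨fun p J hJ => h p J (hJ.trans le_self_add), ?_⟩
    intro J hJ hf
    have := h (π A) (J + Finsupp.single A 1) (add_le_add_left hJ _) (by
      intro e
      have := DFunLike.congr_fun e A
      simp at this) (inFib_add.2 ⟨hf, inFib_single.2 rfl⟩)
    rw [sp_add, sp_single, map_add, Finsupp.degree_single, ← Finset.union_assoc] at this
    exact this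
  · rintro ⟨h1, h2⟩ p J hJ hJ0 hf
    rcases le_add_single.1 hJ with h | ⟨J0, h, rfl⟩
    · exact h1 p J h hJ0 hf
    · rw [inFib_add, inFib_single] at hf
      obtain ⟨hf, rfl⟩ := hf
      have := h2 J0 h hf
      rw [sp_add, sp_single, map_add, Finsupp.degree_single, ← Finset.union_assoc]
      exact this

lemma cd_add {v : FlatVar M →₀ ℕ} {A p : FlatVar M} {X : Finset E} {c : ℕ} (hA : π A = p) :
    M.Cd π P (v + Finsupp.single A 1) p X c ↔
      M.Cd π P v p X c ∧ M.Cd π P v p (A.1 ∪ X) (c + 1) := by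
  constructor
  · intro h
    refine ⟨fun J hJ => h J (hJ.trans le_self_add), ?_⟩
    intro J hJ hf
    have := h (J + Finsupp.single A 1) (add_le_add_left hJ _)
      (inFib_add.2 ⟨hf, inFib_single.2 hA⟩)
    rw [sp_add, sp_single, map_add, Finsupp.degree_single] at this
    simp only [← Finset.union_assoc] at this ⊢
    omega
  · rintro ⟨h1, h2⟩ J hJ hf
    rcases le_add_single.1 hJ with h | ⟨J0, h, rfl⟩
    · exact h1 J h hf
    · rw [inFib_add, inFib_single] at hf
      have := h2 J0 h hf.1
      rw [sp_add, sp_single, map_add, Finsupp.degree_single]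
      simp only [← Finset.union_assoc] at this ⊢
      omega

lemma cd_congr {v : FlatVar M →₀ ℕ} {p : FlatVar M} {X Y : Finset E} {c : ℕ}
    (h : ∀ Z, P p ⊆ Z → M.rho (Z ∪ X) = M.rho (Z ∪ Y)) :
    M.Cd π P v p X c ↔ M.Cd π P v p Y c := by
  unfold Cd
  have : ∀ J, M.rho (P p ∪ sp M J ∪ X) = M.rho (P p ∪ sp M J ∪ Y) :=
    fun J => h _ Finset.subset_union_left
  simp only [this]

lemma cd_key {u : FlatVar M →₀ ℕ} {p : FlatVar M} {X Y : Finset E} (hn : M.Nd π P u)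
    (hz : M.Cd π P u p (X ∪ Y) 2) : M.Cd π P u p X 1 ∨ M.Cd π P u p Y 1 := by
  by_contra hcon
  push Not at hcon
  obtain ⟨h1, h2⟩ := hcon
  unfold Cd at h1 h2
  push Not at h1 h2
  obtain ⟨J, a1, b1, c1⟩ := h1
  obtain ⟨J', a2, b2, c2⟩ := h2
  have hz' := hz (J ⊔ J') (sup_le a1 a2) (by
    intro G hG
    rw [Finsupp.sup_apply] at hG
    by_cases h : J G = 0
    · apply b2; rw [h] at hG; simpa using hG
    · exact b1 G h)
  have hd := degree_sup_inf J J'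
  have hW : (J ⊓ J').degree + M.rho (P p) ≤ M.rho (P p ∪ sp M (J ⊓ J')) := by
    by_cases h0 : J ⊓ J' = 0
    · rw [h0, sp_zero]; simp
    · have := hn p (J ⊓ J') (inf_le_left.trans a1) h0 (by
        intro G hG
        apply b1
        rw [Finsupp.inf_apply] at hG
        intro h
        rw [h] at hG
        simp at hG)
      omega
  have hs := M.rho_submod (P p ∪ sp M J ∪ X) (P p ∪ sp M J' ∪ Y) (P p ∪ sp M (J ⊓ J'))
    ((Finset.union_subset_union_right (sp_mono inf_le_left)).trans Finset.subset_union_left)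
    ((Finset.union_subset_union_right (sp_mono inf_le_right)).trans Finset.subset_union_left)
  have he : P p ∪ sp M J ∪ X ∪ (P p ∪ sp M J' ∪ Y) = P p ∪ sp M (J ⊔ J') ∪ (X ∪ Y) := by
    rw [sp_sup]
    ext a
    simp only [Finset.mem_union]
    tauto
  rw [he] at hs
  omega

lemma cd_weaken {u : FlatVar M →₀ ℕ} {p : FlatVar M} {X : Finset E}
    (hz : M.Cd π P u p X 2) : M.Cd π P u p X 1 := by
  intro J hJ hf
  have := hz J hJ hf
  omega

variable (M π P)

/-- fibre sum condition -/
def Fs (n m : FlatVar M →₀ ℕ) : Prop :=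
  ∀ p, ∑ G ∈ Finset.univ.filter (fun G => π G = p), m G = n p

/-- The full condition -/
def Qc (n m : FlatVar M →₀ ℕ) : Prop := M.Fs π n m ∧ M.Nd π P m

open Classical in
/-- the functional -/
noncomputable def lam (n : FlatVar M →₀ ℕ) : ChowPoly M →ₗ[ℤ] ℤ :=
  (MvPolynomial.basisMonomials (FlatVar M) ℤ).constr ℤ (fun m => if M.Qc π P n m then 1 else 0)

variable {M π P}

open Classical in
lemma lam_monomial (n m : FlatVar M →₀ ℕ) :
    M.lam π P n (MvPolynomial.monomial m 1) = if M.Qc π P n m then 1 else 0 := by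
  have := (MvPolynomial.basisMonomials (FlatVar M) ℤ).constr_basis ℤ
    (fun m => if M.Qc π P n m then (1 : ℤ) else 0) m
  rw [MvPolynomial.coe_basisMonomials] at this
  exact this

lemma fs_congr {n v : FlatVar M →₀ ℕ} {A B : FlatVar M} (h : π A = π B) :
    M.Fs π n (v + Finsupp.single A 1) ↔ M.Fs π n (v + Finsupp.single B 1) := by
  unfold Fs
  have key : ∀ p C, ∑ G ∈ Finset.univ.filter (fun G => π G = p), (Finsupp.single C 1 : _ →₀ ℕ) G
      = if π C = p then 1 else 0 := by
    intro p C
    simp [Finsupp.single_apply]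
  simp only [Finsupp.add_apply, Finset.sum_add_distrib, key, h]

open Classical in
lemma ind_identity {q1 q2 q3 q4 f a b : Prop} (h1 : q1 ↔ f ∧ a ∧ b) (h2 : q2 ↔ f ∧ a)
    (h3 : q3 ↔ f ∧ b) (h4 : q4 ↔ f) (h : f → a ∨ b) :
    (if q1 then (1 : ℤ) else 0) - (if q2 then 1 else 0) - (if q3 then 1 else 0)
      + (if q4 then 1 else 0) = 0 := by
  rw [propext h1, propext h2, propext h3, propext h4]
  by_cases hf : f
  · by_cases ha : a
    · by_cases hb : b <;> simp [hf, ha, hb]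
    · have hb : b := by tauto
      simp [hf, ha, hb]
  · simp [hf]

set_option maxHeartbeats 1000000 in
lemma lam_mul_mem {n : FlatVar M →₀ ℕ}
    (hP1 : ∀ G, ¬ G.1 ⊆ P (π G)) (hPf : ∀ p, P p ∈ M.flats)
    (hP2 : ∀ F G, π F = π G → π (M.join F G) = π G)
    (hP3 : ∀ F G, π F ≠ π G → (F.1 ⊆ P (π G) ∧ π (M.join F G) = π G) ∨
      (G.1 ⊆ P (π F) ∧ π (M.join F G) = π F))
    {p : ChowPoly M} (hp : p ∈ M.KT) (q : ChowPoly M) : M.lam π P n (q * p) = 0 := by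
  classical
  unfold KT at hp
  induction hp using Submodule.span_induction generalizing q with
  | zero => simp
  | add x y _ _ hx hy => rw [mul_add, map_add, hx, hy, add_zero]
  | smul a x _ hx => rw [smul_eq_mul, ← mul_assoc, hx]
  | mem x hx =>
    induction q using MvPolynomial.induction_on' with
    | add p q hp hq => rw [add_mul, map_add, hp, hq, add_zero]
    | monomial u a =>
      have hu : (MvPolynomial.monomial u a : ChowPoly M) = a • MvPolynomial.monomial u 1 := by
        rw [MvPolynomial.smul_monomial, smul_eq_mul, mul_one]
      rw [hu, smul_mul_assoc, map_smul]
      apply smul_eq_zero_of_right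
      have hmul : ∀ v (A : FlatVar M), (MvPolynomial.monomial v 1 : ChowPoly M) *
          MvPolynomial.X A = MvPolynomial.monomial (v + Finsupp.single A 1) 1 := by
        intro v A
        rw [MvPolynomial.X, MvPolynomial.monomial_mul, mul_one]
      rcases hx with ⟨a, rfl⟩ | ⟨F, G, rfl⟩
      · rw [hmul, lam_monomial, if_neg]
        rintro ⟨-, h⟩
        have h1 := (nd_add.1 h).2 0 (by simp) (by intro G hG; simp at hG)
        have h2 : a ∉ P (π (M.atom a)) := by
          intro h
          exact hP1 (M.atom a) (Finset.singleton_subset_iff.2 h)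
        have h3 := M.rho_insert_of_notMem (X := P (π (M.atom a))) (i := a)
          (by rwa [M.cl_flat (hPf _)])
        have h4 : P (π (M.atom a)) ∪ (M.atom a).1 = insert a (P (π (M.atom a))) := by
          ext b; simp [atom]
        rw [sp_zero, Finset.union_empty, h4] at h1
        simp only [map_zero] at h1
        omega
      · set K := M.join F G with hK
        have hexp : (MvPolynomial.monomial u 1 : ChowPoly M) *
          ((MvPolynomial.X F - MvPolynomial.X K) * (MvPolynomial.X G - MvPolynomial.X K)) =
          MvPolynomial.monomial (u + Finsupp.single F 1 + Finsupp.single G 1) 1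
          - MvPolynomial.monomial (u + Finsupp.single F 1 + Finsupp.single K 1) 1
          - MvPolynomial.monomial (u + Finsupp.single G 1 + Finsupp.single K 1) 1
          + MvPolynomial.monomial (u + Finsupp.single K 1 + Finsupp.single K 1) 1 := by
          simp only [← hmul]
          ring
        rw [hexp, map_add, map_sub, map_sub]
        simp only [lam_monomial]
        have swap : ∀ A B : FlatVar M, A.1 ⊆ P (π B) → π (M.join A B) = π B → ∀ v,
            (M.Qc π P n (v + Finsupp.single B 1) ↔
              M.Qc π P n (v + Finsupp.single (M.join A B) 1)) := by
          intro A B h1 h2 v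
          unfold Qc
          rw [fs_congr h2.symm, nd_add, nd_add, h2]
          rw [cd_congr (X := B.1) (Y := (M.join A B).1)]
          intro Z hZ
          change _ = M.rho (Z ∪ M.cl (A.1 ∪ B.1))
          rw [M.rho_union_cl]
          congr 1
          rw [← Finset.union_assoc, Finset.union_eq_left.2 (h1.trans hZ)]
        by_cases hFG : π F = π G
        · have hKG : π K = π G := hP2 F G hFG
          have hrho : ∀ Z, M.rho (Z ∪ K.1) = M.rho (Z ∪ (F.1 ∪ G.1)) := fun Z =>
            M.rho_union_cl Z _
          have f1 : M.Fs π n (u + Finsupp.single F 1 + Finsupp.single K 1) ↔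
              M.Fs π n (u + Finsupp.single F 1 + Finsupp.single G 1) := fs_congr hKG
          have f2 : M.Fs π n (u + Finsupp.single G 1 + Finsupp.single K 1) ↔
              M.Fs π n (u + Finsupp.single F 1 + Finsupp.single G 1) := by
            rw [add_right_comm u (Finsupp.single F 1)]
            exact fs_congr (hKG.trans hFG.symm)
          have f3 : M.Fs π n (u + Finsupp.single K 1 + Finsupp.single K 1) ↔
              M.Fs π n (u + Finsupp.single F 1 + Finsupp.single G 1) := by
            rw [fs_congr (B := F) (hKG.trans hFG.symm), add_right_comm u]
            exact f1
          have z1 : M.Cd π P u (π G) (F.1 ∪ K.1) 2 ↔ M.Cd π P u (π G) (F.1 ∪ G.1) 2 := by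
            apply cd_congr
            intro Z _
            rw [← Finset.union_assoc, hrho]
            congr 1
            ext a; simp only [Finset.mem_union]; tauto
          have z2 : M.Cd π P u (π G) (G.1 ∪ K.1) 2 ↔ M.Cd π P u (π G) (F.1 ∪ G.1) 2 := by
            apply cd_congr
            intro Z _
            rw [← Finset.union_assoc, hrho]
            congr 1
            ext a; simp only [Finset.mem_union]; tauto
          have z3 : M.Cd π P u (π G) K.1 2 ↔ M.Cd π P u (π G) (F.1 ∪ G.1) 2 := by
            apply cd_congr
            intro Z _
            exact hrho Z
          have z4 : M.Cd π P u (π G) (F.1 ∪ G.1) 2 → M.Cd π P u (π G) K.1 1 := fun h =>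
            cd_weaken (z3.2 h)
          have z5 := fun h1 h2 => cd_key (π := π) (P := P) (u := u) (p := π G) (X := F.1)
            (Y := G.1) h1 h2
          have q1 : M.Qc π P n (u + Finsupp.single F 1 + Finsupp.single G 1) ↔
              (M.Fs π n (u + Finsupp.single F 1 + Finsupp.single G 1) ∧ M.Nd π P u ∧
              M.Cd π P u (π G) (F.1 ∪ G.1) 2) ∧ M.Cd π P u (π G) F.1 1 ∧
              M.Cd π P u (π G) G.1 1 := by
            unfold Qc
            rw [nd_add, nd_add, cd_add hFG, hFG]
            exact ⟨fun ⟨f, ⟨n, a⟩, b, z⟩ => ⟨⟨f, n, z⟩, a, b⟩, fun ⟨⟨f, n, z⟩, a, b⟩ => ⟨f, ⟨n, a⟩, b, z⟩⟩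
          have q2 : M.Qc π P n (u + Finsupp.single F 1 + Finsupp.single K 1) ↔
              (M.Fs π n (u + Finsupp.single F 1 + Finsupp.single G 1) ∧ M.Nd π P u ∧
              M.Cd π P u (π G) (F.1 ∪ G.1) 2) ∧ M.Cd π P u (π G) F.1 1 := by
            unfold Qc
            rw [nd_add, nd_add, hKG, cd_add hFG, hFG, z1, f1]
            exact ⟨fun ⟨f, ⟨n, a⟩, _, z⟩ => ⟨⟨f, n, z⟩, a⟩, fun ⟨⟨f, n, z⟩, a⟩ => ⟨f, ⟨n, a⟩, z4 z, z⟩⟩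
          have q3 : M.Qc π P n (u + Finsupp.single G 1 + Finsupp.single K 1) ↔
              (M.Fs π n (u + Finsupp.single F 1 + Finsupp.single G 1) ∧ M.Nd π P u ∧
              M.Cd π P u (π G) (F.1 ∪ G.1) 2) ∧ M.Cd π P u (π G) G.1 1 := by
            unfold Qc
            rw [nd_add, nd_add, hKG, cd_add rfl, z2, f2]
            exact ⟨fun ⟨f, ⟨n, a⟩, _, z⟩ => ⟨⟨f, n, z⟩, a⟩, fun ⟨⟨f, n, z⟩, a⟩ => ⟨f, ⟨n, a⟩, z4 z, z⟩⟩
          have q4 : M.Qc π P n (u + Finsupp.single K 1 + Finsupp.single K 1) ↔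
              (M.Fs π n (u + Finsupp.single F 1 + Finsupp.single G 1) ∧ M.Nd π P u ∧
              M.Cd π P u (π G) (F.1 ∪ G.1) 2) := by
            unfold Qc
            rw [nd_add, nd_add, hKG, cd_add hKG, Finset.union_self, z3, f3]
            exact ⟨fun ⟨f, ⟨n, _⟩, _, z⟩ => ⟨f, n, z⟩, fun ⟨f, n, z⟩ => ⟨f, ⟨n, z4 z⟩, z4 z, z⟩⟩
          exact ind_identity q1 q2 q3 q4 (fun h => z5 h.2.1 h.2.2)
        · rcases hP3 F G hFG with ⟨h1, h2⟩ | ⟨h1, h2⟩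
          · have s := swap F G h1 h2
            have e1 := s (u + Finsupp.single F 1)
            have e2 := s (u + Finsupp.single K 1)
            rw [add_right_comm] at e2
            rw [← hK] at e1 e2
            simp only [e1, e2]
            ring
          · rw [M.join_comm] at h2
            have s := swap G F h1 h2
            have e1 := s (u + Finsupp.single G 1)
            have e2 := s (u + Finsupp.single K 1)
            rw [M.join_comm, ← hK] at e1 e2
            rw [add_right_comm] at e1 e2
            simp only [e1, e2]
            ring

end functional

end SimpleFlatMatroid

namespace SimpleFlatMatroid

section chains

set_option linter.unusedSectionVars false

variable {E : Type*} [Fintype E] [DecidableEq E] (M : SimpleFlatMatroid E)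

/-- chains of flats -/
def IsCh (D : Finset (FlatVar M)) : Prop := ∀ F ∈ D, ∀ G ∈ D, F.1 ⊆ G.1 ∨ G.1 ⊆ F.1

/-- predecessor in a chain -/
def prv (D : Finset (FlatVar M)) (F : FlatVar M) : Finset E :=
  (D.filter (fun G => G.1 ⊂ F.1)).sup Subtype.val

variable {M}

lemma prv_cases {D : Finset (FlatVar M)} (hD : M.IsCh D) (F : FlatVar M) :
    M.prv D F = ∅ ∨ ∃ G ∈ D, G.1 ⊂ F.1 ∧ M.prv D F = G.1 := by
  by_cases h : (D.filter (fun G => G.1 ⊂ F.1)).Nonempty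
  · right
    obtain ⟨G, h1, h2⟩ := Finset.exists_max_image _ (fun G : FlatVar M => G.1.card) h
    obtain ⟨h3, h4⟩ := Finset.mem_filter.1 h1
    refine ⟨G, h3, h4, ?_⟩
    apply le_antisymm
    · apply Finset.sup_le
      intro H hH
      rcases hD H (Finset.mem_filter.1 hH).1 G h3 with e | e
      · exact e
      · exact (Finset.eq_of_subset_of_card_le e (h2 H hH)).ge
    · exact Finset.le_sup (f := Subtype.val) h1
  · left
    rw [Finset.not_nonempty_iff_eq_empty] at h
    rw [prv, h]
    rfl

lemma le_prv {D : Finset (FlatVar M)} {F G : FlatVar M} (hG : G ∈ D) (h : G.1 ⊂ F.1) :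
    G.1 ⊆ M.prv D F :=
  Finset.le_sup (f := Subtype.val) (Finset.mem_filter.2 ⟨hG, h⟩)

lemma prv_mem {D : Finset (FlatVar M)} (hD : M.IsCh D) (F : FlatVar M) :
    M.prv D F ∈ M.flats := by
  rcases prv_cases hD F with h | ⟨G, _, _, h⟩
  · rw [h]; exact M.empty_mem
  · rw [h]; exact G.2.1

lemma prv_ssubset {D : Finset (FlatVar M)} (hD : M.IsCh D) (F : FlatVar M) :
    M.prv D F ⊂ F.1 := by
  rcases prv_cases hD F with h | ⟨G, _, h', h⟩
  · rw [h]; exact Finset.empty_ssubset.2 (Finset.nonempty_iff_ne_empty.2 F.2.2)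
  · rw [h]; exact h'

variable (M) [Nonempty E]

/-- the top flat -/
def tp : FlatVar M := ⟨Finset.univ, M.ground_mem, Finset.univ_nonempty.ne_empty⟩

lemma exists_pi {D : Finset (FlatVar M)} (hD : M.IsCh D) (ht : M.tp ∈ D) (G : FlatVar M) :
    ∃ F ∈ D, G.1 ⊆ F.1 ∧ ∀ F' ∈ D, G.1 ⊆ F'.1 → F.1 ⊆ F'.1 := by
  obtain ⟨F, h1, h2⟩ := Finset.exists_min_image (D.filter (fun F => G.1 ⊆ F.1))
    (fun G : FlatVar M => G.1.card) ⟨M.tp, Finset.mem_filter.2 ⟨ht, Finset.subset_univ _⟩⟩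
  obtain ⟨h3, h4⟩ := Finset.mem_filter.1 h1
  refine ⟨F, h3, h4, ?_⟩
  intro F' h5 h6
  rcases hD F h3 F' h5 with e | e
  · exact e
  · exact (Finset.eq_of_subset_of_card_le e (h2 F' (Finset.mem_filter.2 ⟨h5, h6⟩))).ge

/-- support with top added -/
def sD (m : FlatVar M →₀ ℕ) : Finset (FlatVar M) := insert M.tp m.support

/-- Feichtner-Yuzvinsky exponents -/
def FYm (m : FlatVar M →₀ ℕ) : Prop :=
  M.IsCh (M.sD m) ∧ ∀ F ∈ M.sD m, m F + M.rk (M.prv (M.sD m) F) + 1 ≤ M.rk F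

/-- weight -/
def wt (m : FlatVar M →₀ ℕ) : ℕ := ∑ G, m G * G.1.card

lemma exists_functional (n : FlatVar M →₀ ℕ) (hn : M.FYm n) :
    ∃ l : ChowPoly M →ₗ[ℤ] ℤ, (∀ p ∈ M.KT, l p = 0) ∧ l (MvPolynomial.monomial n 1) = 1 ∧
      ∀ m, l (MvPolynomial.monomial m 1) ≠ 0 → m = n ∨ M.wt m < M.wt n := by
  classical
  obtain ⟨hD, hr⟩ := hn
  set D := M.sD n with hDdef
  have ht : M.tp ∈ D := Finset.mem_insert_self _ _
  choose π hπ1 hπ2 hπ3 using M.exists_pi hD ht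
  have hj : ∀ F G, F.1 ⊆ (π G).1 → π (M.join F G) = π G := by
    intro F G h
    apply Subtype.ext
    apply Finset.Subset.antisymm
    · exact hπ3 _ _ (hπ1 G) (M.join_le h (hπ2 G))
    · exact hπ3 _ _ (hπ1 _) ((M.right_le_join F G).trans (hπ2 _))
  have hfix : ∀ F ∈ D, π F = F := fun F hF =>
    Subtype.ext (Finset.Subset.antisymm (hπ3 F F hF (Finset.Subset.refl _)) (hπ2 F))
  have hoff : ∀ F, F ∉ D → n F = 0 := by
    intro F hF
    by_contra h
    exact hF (Finset.mem_insert_of_mem (Finsupp.mem_support_iff.2 h))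
  refine ⟨M.lam π (M.prv D) n, ?_, ?_, ?_⟩
  · intro p hp
    rw [← one_mul p]
    refine lam_mul_mem ?_ (prv_mem hD) ?_ ?_ hp 1
    · intro G h
      rcases prv_cases hD (π G) with e | ⟨H, h1, h2, e⟩
      · rw [e] at h
        exact G.2.2 (Finset.subset_empty.1 h)
      · rw [e] at h
        exact h2.2 (hπ3 G H h1 h)
    · intro F G h
      exact hj F G (h ▸ hπ2 F)
    · intro F G h
      have h' : (π F).1 ≠ (π G).1 := fun e => h (Subtype.ext e)
      rcases hD _ (hπ1 F) _ (hπ1 G) with e | e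
      · left
        exact ⟨(hπ2 F).trans (le_prv (hπ1 F) (Finset.ssubset_iff_subset_ne.2 ⟨e, h'⟩)),
          hj F G ((hπ2 F).trans e)⟩
      · right
        refine ⟨(hπ2 G).trans (le_prv (hπ1 G) (Finset.ssubset_iff_subset_ne.2 ⟨e, h'.symm⟩)), ?_⟩
        rw [M.join_comm]
        exact hj G F ((hπ2 G).trans e)
  · rw [lam_monomial, if_pos]
    refine ⟨?_, ?_⟩
    · intro p
      by_cases hp : p ∈ D
      · rw [Finset.sum_eq_single_of_mem p (by simp [hfix p hp])]
        intro G hG hne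
        apply hoff
        intro hGD
        apply hne
        rw [← (Finset.mem_filter.1 hG).2, hfix G hGD]
      · rw [hoff p hp]
        apply Finset.sum_eq_zero
        intro G hG
        exact (hp ((Finset.mem_filter.1 hG).2 ▸ hπ1 G)).elim
    · intro p J hJ hJ0 hf
      have hs : ∀ G, J G ≠ 0 → G = p := by
        intro G hG
        rw [← hf G hG]
        symm
        apply hfix
        by_contra h
        have := hJ G
        rw [hoff G h] at this
        omega
      have hJs : J = Finsupp.single p (J p) := by
        ext G
        by_cases h : G = p
        · subst h; simp
        · rw [Finsupp.single_eq_of_ne h]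
          by_contra h'
          exact h (hs G h')
      have hJp : J p ≠ 0 := by
        intro h
        apply hJ0
        rw [hJs, h]
        simp
      have hpD : p ∈ D := by
        by_contra h
        have := hJ p
        rw [hoff p h] at this
        omega
      have hsp : sp M J = p.1 := by
        ext a
        rw [mem_sp]
        constructor
        · rintro ⟨G, h1, h2⟩
          rw [← hs G h1]; exact h2
        · intro h
          exact ⟨p, hJp, h⟩
      have hdeg : J.degree = J p := by
        rw [hJs]; simp
      rw [hsp, hdeg, Finset.union_eq_right.2 (prv_ssubset hD p).subset, M.rho_flat p.2.1,
        M.rho_flat (prv_mem hD p)]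
      have := hr p hpD
      have := hJ p
      omega
  · intro m hm
    rw [lam_monomial] at hm
    have hq : M.Fs π n m := by
      by_contra h
      apply hm
      rw [if_neg]
      exact fun h' => h h'.1
    have hle : ∀ G : FlatVar M, m G * G.1.card ≤ m G * (π G).1.card := fun G =>
      Nat.mul_le_mul_left _ (Finset.card_le_card (hπ2 G))
    have hw : ∑ G, m G * (π G).1.card = M.wt n := by
      unfold wt
      rw [← Finset.sum_fiberwise Finset.univ π]
      apply Finset.sum_congr rfl
      intro p _
      rw [← hq p, Finset.sum_mul]
      apply Finset.sum_congr rfl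
      intro G hG
      rw [(Finset.mem_filter.1 hG).2]
    by_cases hex : ∃ G, m G * G.1.card < m G * (π G).1.card
    · right
      rw [← hw]
      obtain ⟨G, hG⟩ := hex
      exact Finset.sum_lt_sum (fun G _ => hle G) ⟨G, Finset.mem_univ _, hG⟩
    · left
      push Not at hex
      have hmD : ∀ G, m G ≠ 0 → π G = G := by
        intro G hG
        have h1 := Nat.le_of_mul_le_mul_left (hex G) (Nat.pos_of_ne_zero hG)
        exact (Subtype.ext (Finset.eq_of_subset_of_card_le (hπ2 G) h1)).symm
      ext p
      rw [← hq p]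
      by_cases hp : π p = p
      · rw [Finset.sum_eq_single_of_mem p (by simp [hp])]
        intro G hG hne
        by_contra h
        apply hne
        rw [← (Finset.mem_filter.1 hG).2, hmD G h]
      · have h0 : m p = 0 := by
          by_contra h
          exact hp (hmD p h)
        rw [h0]
        symm
        apply Finset.sum_eq_zero
        intro G hG
        by_contra h
        have e := hmD G h
        rw [(Finset.mem_filter.1 hG).2] at e
        rw [← e] at hG
        exact hp (Finset.mem_filter.1 hG).2

/-- monomials in the simplicial generators -/
noncomputable def ym (m : FlatVar M →₀ ℕ) : ChowRing M :=
  M.chowMk (M.phi (MvPolynomial.monomial m 1))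

lemma ym_indep : LinearIndependent ℤ (fun m : {m // M.FYm m} => M.ym m.1) := by
  classical
  rw [linearIndependent_iff']
  intro s g hs
  by_contra hcon
  push Not at hcon
  obtain ⟨i0, hi0, hg0⟩ := hcon
  obtain ⟨n, h1, h2⟩ := Finset.exists_min_image (s.filter (fun i => g i ≠ 0))
    (fun i => M.wt i.1) ⟨i0, Finset.mem_filter.2 ⟨hi0, hg0⟩⟩
  obtain ⟨h3, h4⟩ := Finset.mem_filter.1 h1
  obtain ⟨l, l1, l2, l3⟩ := M.exists_functional n.1 n.2
  apply h4
  have e1 : M.chowMk (M.phi (∑ i ∈ s, g i • MvPolynomial.monomial i.1 1)) = 0 := by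
    rw [← hs]
    simp only [map_sum, map_smul, ym]
  rw [chowMk, Ideal.Quotient.mkₐ_eq_mk, Ideal.Quotient.eq_zero_iff_mem] at e1
  have e2 := l1 _ (M.psi_mem _ e1)
  rw [psi_phi, map_sum] at e2
  rw [Finset.sum_eq_single_of_mem n h3] at e2
  · rw [map_smul, l2] at e2
    simpa using e2
  · intro i hi hne
    rw [map_smul]
    by_cases hgi : g i = 0
    · rw [hgi, zero_smul]
    · apply smul_eq_zero_of_right
      by_contra h
      rcases l3 _ h with h' | h'
      · exact hne (Subtype.ext h')
      · have := h2 i (Finset.mem_filter.2 ⟨hi, hgi⟩)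
        omega

lemma ym_mul (u : FlatVar M →₀ ℕ) (F : FlatVar M) (d : ℕ) :
    M.ym (u + Finsupp.single F d) = M.ym u * M.y F ^ d := by
  have : (MvPolynomial.monomial (u + Finsupp.single F d) 1 : ChowPoly M) =
      MvPolynomial.monomial u 1 * MvPolynomial.X F ^ d := by
    rw [MvPolynomial.X_pow_eq_monomial, MvPolynomial.monomial_mul, mul_one]
  rw [ym, this, map_mul, map_mul, map_pow, map_pow, phi, MvPolynomial.aeval_X]
  rfl

lemma wt_add (m n : FlatVar M →₀ ℕ) : M.wt (m + n) = M.wt m + M.wt n := by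
  simp [wt, add_mul, Finset.sum_add_distrib]

lemma wt_single (F : FlatVar M) (d : ℕ) : M.wt (Finsupp.single F d) = d * F.1.card := by
  unfold wt
  rw [Finset.sum_eq_single_of_mem F (Finset.mem_univ _)]
  · simp
  · intro G _ h
    rw [Finsupp.single_eq_of_ne h, zero_mul]

lemma wt_le (m : FlatVar M →₀ ℕ) : M.wt m ≤ m.degree * Fintype.card E := by
  rw [Finsupp.degree_eq_sum, Finset.sum_mul]
  exact Finset.sum_le_sum fun G _ => Nat.mul_le_mul_left _ (Finset.card_le_univ _)

lemma ym_span (k : ℕ) (m : FlatVar M →₀ ℕ) (hm : m.degree = k) :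
    M.ym m ∈ Submodule.span ℤ {z | ∃ n, M.FYm n ∧ n.degree = k ∧ z = M.ym n} := by
  classical
  induction hN : k * Fintype.card E - M.wt m using Nat.strong_induction_on generalizing m with
  | _ N ih =>
    have ih' : ∀ m' : FlatVar M →₀ ℕ, m'.degree = k → M.wt m < M.wt m' →
        M.ym m' ∈ Submodule.span ℤ {z | ∃ n, M.FYm n ∧ n.degree = k ∧ z = M.ym n} := by
      intro m' h1 h2
      have := M.wt_le m'
      rw [h1] at this
      exact ih _ (by omega) m' h1 rfl
    by_cases hFY : M.FYm m
    · exact Submodule.subset_span ⟨m, hFY, hm, rfl⟩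
    by_cases hch : M.IsCh (M.sD m)
    · have : ∃ F ∈ M.sD m, M.rk F.1 < m F + M.rk (M.prv (M.sD m) F) + 1 := by
        by_contra h
        push Not at h
        exact hFY ⟨hch, h⟩
      obtain ⟨F, hF, hlt⟩ := this
      rcases prv_cases hch F with e | ⟨G, h1, h2, e⟩
      · rw [e, M.rk_empty] at hlt
        have : m = (m - Finsupp.single F (M.rk F.1)) + Finsupp.single F (M.rk F.1) := by
          rw [tsub_add_cancel_of_le]
          rw [Finsupp.single_le_iff]
          omega
        rw [this, ym_mul, M.y_zero _ F rfl, mul_zero]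
        exact Submodule.zero_mem _
      · have hrk := M.rk_lt G.2.1 F.2.1 h2
        rw [e] at hlt
        obtain ⟨d, hd⟩ := Nat.exists_eq_add_of_lt hrk
        have hGs : m G ≠ 0 := by
          rcases Finset.mem_insert.1 h1 with h | h
          · exact (h2.2 (by rw [h]; exact Finset.subset_univ _)).elim
          · exact Finsupp.mem_support_iff.1 h
        have hne : G ≠ F := by
          rintro rfl
          exact h2.2 (Finset.Subset.refl _)
        obtain ⟨u, hu⟩ : ∃ u, m = u + Finsupp.single G 1 + Finsupp.single F (d + 1) := by
          refine ⟨m - (Finsupp.single G 1 + Finsupp.single F (d + 1)), ?_⟩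
          rw [add_assoc, tsub_add_cancel_of_le]
          intro H
          rw [Finsupp.add_apply, Finsupp.single_apply, Finsupp.single_apply]
          split_ifs with c1 c2 c2
          · exact (hne (c1.trans c2.symm)).elim
          · rw [← c1]; omega
          · rw [← c2]; omega
          · omega
        have hy : M.ym m = M.ym (u + Finsupp.single F (d + 2)) := by
          rw [hu, ym_mul, ym_mul, ym_mul, pow_one, mul_assoc,
            M.y_rel (d + 1) G F h2.subset (by omega)]
        rw [hy]
        have hc := Finset.card_lt_card h2
        apply ih'
        · rw [← hm, hu]
          simp only [map_add, Finsupp.degree_single]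
          omega
        · rw [hu]
          simp only [wt_add, wt_single]
          nlinarith
    · unfold IsCh at hch
      push Not at hch
      obtain ⟨F, hF, G, hG, h1, h2⟩ := hch
      have hFs : m F ≠ 0 := by
        rcases Finset.mem_insert.1 hF with h | h
        · exact (h2 (by rw [h]; exact Finset.subset_univ _)).elim
        · exact Finsupp.mem_support_iff.1 h
      have hGs : m G ≠ 0 := by
        rcases Finset.mem_insert.1 hG with h | h
        · exact (h1 (by rw [h]; exact Finset.subset_univ _)).elim
        · exact Finsupp.mem_support_iff.1 h
      have hne : F ≠ G := by
        rintro rfl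
        exact h2 (Finset.Subset.refl _)
      obtain ⟨u, hu⟩ : ∃ u, m = u + Finsupp.single F 1 + Finsupp.single G 1 := by
        refine ⟨m - (Finsupp.single F 1 + Finsupp.single G 1), ?_⟩
        rw [add_assoc, tsub_add_cancel_of_le]
        intro H
        rw [Finsupp.add_apply, Finsupp.single_apply, Finsupp.single_apply]
        split_ifs with c1 c2 c2
        · exact (hne (c1.trans c2.symm)).elim
        · rw [← c1]; omega
        · rw [← c2]; omega
        · omega
      set K := M.join F G with hK
      have cF : F.1.card < K.1.card := by
        apply Finset.card_lt_card
        refine Finset.ssubset_iff_subset_ne.2 ⟨M.left_le_join _ _, fun e => h2 ?_⟩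
        rw [e]; exact M.right_le_join _ _
      have cG : G.1.card < K.1.card := by
        apply Finset.card_lt_card
        refine Finset.ssubset_iff_subset_ne.2 ⟨M.right_le_join _ _, fun e => h1 ?_⟩
        rw [e]; exact M.left_le_join _ _
      have hy : M.ym m = M.ym (u + Finsupp.single F 1 + Finsupp.single K 1) +
          M.ym (u + Finsupp.single G 1 + Finsupp.single K 1) -
          M.ym (u + Finsupp.single K 1 + Finsupp.single K 1) := by
        rw [hu]
        simp only [ym_mul, pow_one]
        have := M.y_quad F G
        linear_combination M.ym u * this
      have hmd : u.degree + 1 + 1 = k := by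
        rw [← hm, hu]
        simp only [map_add, Finsupp.degree_single]
      have hmw : M.wt m = M.wt u + 1 * F.1.card + 1 * G.1.card := by
        rw [hu]
        simp only [wt_add, wt_single]
      rw [hy]
      apply Submodule.sub_mem
      · apply Submodule.add_mem
        · apply ih'
          · simp only [map_add, Finsupp.degree_single]; omega
          · simp only [wt_add, wt_single]; omega
        · apply ih'
          · simp only [map_add, Finsupp.degree_single]; omega
          · simp only [wt_add, wt_single]; omega
      · apply ih'
        · simp only [map_add, Finsupp.degree_single]; omega
        · simp only [wt_add, wt_single]; omega

lemma ym_mem (m : FlatVar M →₀ ℕ) : M.ym m ∈ M.chowComp m.degree := by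
  refine Submodule.mem_map_of_mem (f := (M.chowMk).toLinearMap) ?_
  rw [MvPolynomial.mem_homogeneousSubmodule]
  have h := (MvPolynomial.isHomogeneous_monomial (n := m.degree) (1 : ℤ) rfl).aeval
    M.hX M.hX_hom
  rw [one_mul] at h
  exact h

lemma chowComp_eq (k : ℕ) :
    M.chowComp k = Submodule.span ℤ {z | ∃ n, M.FYm n ∧ n.degree = k ∧ z = M.ym n} := by
  apply le_antisymm
  · rintro z ⟨p, hp, rfl⟩
    have hp' : (M.psi p).IsHomogeneous k := by
      have h := MvPolynomial.IsHomogeneous.aeval hp M.psiX M.psiX_hom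
      rw [one_mul] at h
      exact h
    change M.chowMk p ∈ _
    rw [← M.phi_psi p, (M.psi p).as_sum, map_sum, map_sum]
    apply Submodule.sum_mem
    intro m hm
    have hmd : m.degree = k := by
      have := hp' (MvPolynomial.mem_support_iff.1 hm)
      rw [← this, Finsupp.degree_eq_weight_one]
      rfl
    have : (MvPolynomial.monomial m (MvPolynomial.coeff m (M.psi p)) : ChowPoly M) =
        MvPolynomial.coeff m (M.psi p) • MvPolynomial.monomial m 1 := by
      rw [MvPolynomial.smul_monomial, smul_eq_mul, mul_one]
    rw [this, map_smul, map_smul]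
    apply Submodule.smul_mem
    exact M.ym_span k m hmd
  · rw [Submodule.span_le]
    rintro z ⟨n, _, rfl, rfl⟩
    exact M.ym_mem n

lemma finrank_chowComp (k : ℕ) :
    Module.finrank ℤ (M.chowComp k) = Nat.card {m // M.FYm m ∧ m.degree = k} := by
  have h1 : LinearIndependent ℤ (fun m : {m // M.FYm m ∧ m.degree = k} => M.ym m.1) := by
    have := M.ym_indep.comp (fun m : {m // M.FYm m ∧ m.degree = k} => ⟨m.1, m.2.1⟩) (by
      intro a b h
      simpa [Subtype.ext_iff] using h)
    exact this
  have h2 : Set.range (fun m : {m // M.FYm m ∧ m.degree = k} => M.ym m.1) =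
      {z | ∃ n, M.FYm n ∧ n.degree = k ∧ z = M.ym n} := by
    ext z
    constructor
    · rintro ⟨m, rfl⟩
      exact ⟨m.1, m.2.1, m.2.2, rfl⟩
    · rintro ⟨n, a, b, rfl⟩
      exact ⟨⟨n, a, b⟩, rfl⟩
  rw [chowComp_eq, ← h2]
  exact Module.finrank_eq_nat_card_basis (Module.Basis.span h1)

end chains

end SimpleFlatMatroid

namespace SimpleFlatMatroid

section unimodal

/-- symmetric unimodal with centre `c / 2` -/
def SU (c : ℤ) (a : ℤ → ℕ) : Prop := (∀ i, a (c - i) = a i) ∧ ∀ i, 2 * i < c → a i ≤ a (i + 1)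

lemma SU.mono {c : ℤ} {a : ℤ → ℕ} (h : SU c a) (y : ℤ) (n : ℕ) (hn : 2 * (y + n) ≤ c + 1) :
    a y ≤ a (y + n) := by
  induction n with
  | zero => simp
  | succ n ih =>
    push_cast at hn ⊢
    have h1 := ih (by omega)
    have h2 := h.2 (y + n) (by omega)
    rw [← add_assoc]
    exact h1.trans h2

lemma SU.mono' {c : ℤ} {a : ℤ → ℕ} (h : SU c a) (y : ℤ) (n : ℕ) (hn : 2 * y + n ≤ c) :
    a y ≤ a (y + n) := by
  by_cases h1 : 2 * (y + n) ≤ c + 1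
  · exact h.mono y n h1
  · rw [← h.1 (y + n)]
    obtain ⟨t, ht⟩ := Int.eq_ofNat_of_zero_le (a := c - (y + n) - y) (by omega)
    have := h.mono y t (by omega)
    rw [show y + (t : ℤ) = c - (y + n) by omega] at this
    exact this

lemma SU.step {c : ℤ} {a : ℤ → ℕ} (h : SU c a) (lo n : ℕ) :
    SU (c + (2 * lo + n - 1)) (fun i => ∑ t ∈ Finset.range n, a (i - lo - t)) := by
  constructor
  · intro i
    simp only
    rw [← Finset.sum_range_reflect]
    apply Finset.sum_congr rfl
    intro t ht
    rw [← h.1]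
    congr 1
    have := Finset.mem_range.1 ht
    have e : ((n - 1 - t : ℕ) : ℤ) = n - 1 - t := by omega
    rw [e]
    ring
  · intro i hi
    simp only
    have h1 : ∑ t ∈ Finset.range n, a (i + 1 - lo - t) + a (i + 1 - lo - n) =
        ∑ t ∈ Finset.range n, a (i - lo - t) + a (i + 1 - lo) := by
      rw [← Finset.sum_range_succ (fun t : ℕ => a (i + 1 - lo - t)), Finset.sum_range_succ']
      congr 1
      · apply Finset.sum_congr rfl
        intro t _
        congr 1
        push_cast
        ring
      · simp
    have h2 := h.mono' (i + 1 - lo - n) n (by omega)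
    rw [show i + 1 - (lo : ℤ) - n + n = i + 1 - lo by ring] at h2
    omega

lemma SU.sum {ι : Type*} (s : Finset ι) {c : ℤ} {a : ι → ℤ → ℕ} (h : ∀ i ∈ s, SU c (a i)) :
    SU c (fun k => ∑ i ∈ s, a i k) :=
  ⟨fun k => Finset.sum_congr rfl fun i hi => (h i hi).1 k,
    fun k hk => Finset.sum_le_sum fun i hi => (h i hi).2 k hk⟩

/-- integer-indexed coefficients -/
noncomputable def cz (p : Polynomial ℕ) (i : ℤ) : ℕ := if 0 ≤ i then p.coeff i.toNat else 0

lemma cz_natCast (p : Polynomial ℕ) (k : ℕ) : cz p k = p.coeff k := by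
  simp [cz]

lemma cz_mul_X_pow (p : Polynomial ℕ) (j : ℕ) (i : ℤ) :
    cz (p * Polynomial.X ^ j) i = cz p (i - j) := by
  unfold cz
  rw [Polynomial.coeff_mul_X_pow']
  by_cases h : 0 ≤ i
  · by_cases h' : (j : ℤ) ≤ i
    · rw [if_pos h, if_pos (by omega), if_pos (by omega)]
      congr 1
      omega
    · rw [if_pos h, if_neg (by omega), if_neg (by omega)]
  · rw [if_neg h, if_neg (by omega)]

lemma cz_sum {ι : Type*} (s : Finset ι) (f : ι → Polynomial ℕ) (i : ℤ) :
    cz (∑ j ∈ s, f j) i = ∑ j ∈ s, cz (f j) i := by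
  unfold cz
  by_cases h : 0 ≤ i
  · simp [h]
  · simp [h]

lemma SU_prod {ι : Type*} [DecidableEq ι] (s : Finset ι) (lo n : ι → ℕ) :
    SU (∑ F ∈ s, (2 * (lo F : ℤ) + n F - 1))
      (cz (∏ F ∈ s, ∑ j ∈ Finset.Ico (lo F) (lo F + n F), Polynomial.X ^ j)) := by
  induction s using Finset.induction_on with
  | empty =>
    simp only [Finset.sum_empty, Finset.prod_empty]
    have h1 : ∀ i : ℤ, cz 1 i = if i = 0 then 1 else 0 := by
      intro i
      unfold cz
      rw [Polynomial.coeff_one]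
      split_ifs <;> first | rfl | omega
    constructor
    · intro i
      rw [h1, h1]
      split_ifs <;> first | rfl | omega
    · intro i hi
      rw [h1, if_neg (by omega)]
      exact Nat.zero_le _
  | insert F s hF ih =>
    rw [Finset.sum_insert hF, Finset.prod_insert hF, add_comm,
      mul_comm (∑ j ∈ Finset.Ico (lo F) (lo F + n F), (Polynomial.X : Polynomial ℕ) ^ j)]
    have := ih.step (lo F) (n F)
    convert this using 1
    funext i
    rw [Finset.mul_sum, cz_sum, Finset.sum_Ico_eq_sum_range, Nat.add_sub_cancel_left]
    apply Finset.sum_congr rfl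
    intro t _
    rw [cz_mul_X_pow]
    congr 1
    push_cast
    ring

lemma card_pi {ι : Type*} [Fintype ι] [DecidableEq ι] (t : ι → Finset ℕ) (k : ℕ) :
    ((Fintype.piFinset t).filter (fun p => ∑ x, p x = k)).card =
      (∏ F, ∑ j ∈ t F, (Polynomial.X : Polynomial ℕ) ^ j).coeff k := by
  rw [Finset.prod_univ_sum, Polynomial.finsetSum_coeff, Finset.card_filter]
  apply Finset.sum_congr rfl
  intro p _
  rw [Finset.prod_pow_eq_pow_sum, Polynomial.coeff_X_pow]
  simp only [eq_comm]

end unimodal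

section count

variable {E : Type*} [Fintype E] [DecidableEq E] (M : SimpleFlatMatroid E)

lemma telescope (D : Finset (FlatVar M)) (hD : M.IsCh D) :
    ∑ F ∈ D, ((M.rk F.1 : ℤ) - M.rk (M.prv D F)) = M.rk (D.sup Subtype.val) := by
  induction hn : D.card generalizing D with
  | zero =>
    rw [Finset.card_eq_zero] at hn
    subst hn
    simp [M.rk_empty]
  | succ n ih =>
    obtain ⟨G, hG, hmax⟩ := Finset.exists_max_image D (fun G : FlatVar M => G.1.card)
      (Finset.card_pos.1 (by omega))
    have hle : ∀ F ∈ D, F.1 ⊆ G.1 := by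
      intro F hF
      rcases hD F hF G hG with e | e
      · exact e
      · exact (Finset.eq_of_subset_of_card_le e (hmax F hF)).ge
    have hD' : M.IsCh (D.erase G) := fun F hF H hH =>
      hD F (Finset.mem_of_mem_erase hF) H (Finset.mem_of_mem_erase hH)
    have h1 := ih (D.erase G) hD' (by rw [Finset.card_erase_of_mem hG, hn]; rfl)
    rw [← Finset.add_sum_erase _ _ hG]
    have h2 : M.prv D G = (D.erase G).sup Subtype.val := by
      unfold prv
      congr 1
      ext F
      rw [Finset.mem_filter, Finset.mem_erase]
      constructor
      · rintro ⟨a, b⟩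
        exact ⟨fun e => b.2 (by rw [e]), a⟩
      · rintro ⟨a, b⟩
        exact ⟨b, Finset.ssubset_iff_subset_ne.2 ⟨hle F b, fun e => a (Subtype.ext e)⟩⟩
    have h3 : ∀ F ∈ D.erase G, M.prv D F = M.prv (D.erase G) F := by
      intro F hF
      unfold prv
      congr 1
      ext H
      rw [Finset.mem_filter, Finset.mem_filter, Finset.mem_erase]
      constructor
      · rintro ⟨a, b⟩
        refine ⟨⟨?_, a⟩, b⟩
        rintro rfl
        exact b.2 (hle F (Finset.mem_of_mem_erase hF))
      · rintro ⟨⟨_, a⟩, b⟩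
        exact ⟨a, b⟩
    have h4 : D.sup Subtype.val = G.1 :=
      le_antisymm (Finset.sup_le hle) (Finset.le_sup (f := Subtype.val) hG)
    rw [Finset.sum_congr rfl (fun F hF => by rw [h3 F hF]), h1, h2, h4]
    ring

variable [Nonempty E]

/-- lower bound for exponents -/
def lo (D : Finset (FlatVar M)) (F : FlatVar M) : ℕ := if F ∈ D ∧ F ≠ M.tp then 1 else 0

/-- number of allowed exponents -/
def nn (D : Finset (FlatVar M)) (F : FlatVar M) : ℕ :=
  if F ∈ D then M.rk F.1 - M.rk (M.prv D F) - M.lo D F else 1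

/-- exponent functions with given chain -/
def box (D : Finset (FlatVar M)) : Finset (FlatVar M → ℕ) :=
  Fintype.piFinset (fun F => Finset.Ico (M.lo D F) (M.lo D F + M.nn D F))

variable {M}

lemma box_iff {D : Finset (FlatVar M)} (hD : M.IsCh D) (ht : M.tp ∈ D) (m : FlatVar M →₀ ℕ) :
    (m : FlatVar M → ℕ) ∈ M.box D ↔ M.sD m = D ∧ M.FYm m := by
  have hd : ∀ F : FlatVar M, M.rk (M.prv D F) < M.rk F.1 := fun F =>
    M.rk_lt (prv_mem hD F) F.2.1 (prv_ssubset hD F)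
  unfold box
  rw [Fintype.mem_piFinset]
  simp only [Finset.mem_Ico]
  constructor
  · intro h
    have hs : M.sD m = D := by
      ext F
      rw [sD, Finset.mem_insert, Finsupp.mem_support_iff]
      have h1 := h F
      unfold nn lo at h1
      by_cases hF : F ∈ D
      · by_cases hF' : F = M.tp
        · simp [hF', ht]
        · simp only [hF, hF', ne_eq, not_false_eq_true, and_self, if_true] at h1
          simp only [hF, iff_true]
          right
          omega
      · simp only [hF, false_and, if_false] at h1
        simp only [hF, iff_false, not_or, not_not]
        exact ⟨fun e => hF (e ▸ ht), by omega⟩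
    refine ⟨hs, ?_⟩
    unfold FYm
    rw [hs]
    refine ⟨hD, ?_⟩
    intro F hF
    have h1 := h F
    have h2 := hd F
    unfold nn lo at h1
    rw [if_pos hF] at h1
    split_ifs at h1 <;> omega
  · rintro ⟨rfl, h⟩ F
    have h2 := hd F
    unfold nn lo
    by_cases hF : F ∈ M.sD m
    · have h3 := h.2 F hF
      rw [if_pos hF]
      by_cases hF' : F = M.tp
      · simp only [hF', ne_eq, not_true_eq_false, and_false, if_false] at h3 ⊢
        omega
      · simp only [hF, hF', ne_eq, not_false_eq_true, and_self, if_true]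
        have : m F ≠ 0 := by
          rcases Finset.mem_insert.1 hF with e | e
          · exact (hF' e).elim
          · exact Finsupp.mem_support_iff.1 e
        omega
    · have : m F = 0 := by
        by_contra e
        exact hF (Finset.mem_insert_of_mem (Finsupp.mem_support_iff.2 e))
      simp [hF, this]

lemma center {D : Finset (FlatVar M)} (hD : M.IsCh D) (ht : M.tp ∈ D) :
    ∑ F, (2 * (M.lo D F : ℤ) + M.nn D F - 1) = M.rk Finset.univ - 1 := by
  have hd : ∀ F : FlatVar M, M.rk (M.prv D F) < M.rk F.1 := fun F =>
    M.rk_lt (prv_mem hD F) F.2.1 (prv_ssubset hD F)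
  have h1 : ∀ F, (2 * (M.lo D F : ℤ) + M.nn D F - 1) =
      (if F ∈ D then ((M.rk F.1 : ℤ) - M.rk (M.prv D F)) else 0) - (if F = M.tp then 1 else 0) := by
    intro F
    have := hd F
    unfold nn lo
    by_cases hF : F ∈ D
    · by_cases hF' : F = M.tp
      · subst hF'
        simp only [ht, ne_eq, not_true_eq_false, and_false, if_false, if_true]
        omega
      · simp only [hF, hF', ne_eq, not_false_eq_true, and_self, if_true, if_false]
        omega
    · have hF' : F ≠ M.tp := fun e => hF (e ▸ ht)
      simp [hF, hF']
  rw [Finset.sum_congr rfl (fun F _ => h1 F), Finset.sum_sub_distrib, Finset.sum_ite_eq',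
    if_pos (Finset.mem_univ _), Finset.sum_ite_mem, Finset.univ_inter, M.telescope D hD]
  have : D.sup Subtype.val = (Finset.univ : Finset E) :=
    le_antisymm (Finset.subset_univ _) (Finset.le_sup (f := Subtype.val) ht)
  rw [this]

open Classical in
lemma card_FY (k : ℕ) : Nat.card {m // M.FYm m ∧ m.degree = k} =
    ∑ D ∈ (Finset.univ : Finset (Finset (FlatVar M))).filter (fun D => M.IsCh D ∧ M.tp ∈ D),
      cz (∏ F, ∑ j ∈ Finset.Ico (M.lo D F) (M.lo D F + M.nn D F), Polynomial.X ^ j) k := by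
  simp only [cz_natCast, ← card_pi]
  rw [← Finset.card_biUnion]
  · rw [← Fintype.card_coe, ← Nat.card_eq_fintype_card]
    apply Nat.card_congr
    apply Equiv.subtypeEquiv Finsupp.equivFunOnFinite
    intro m
    rw [Finset.mem_biUnion]
    simp only [Finset.mem_filter, Finset.mem_univ, true_and, Finsupp.equivFunOnFinite_apply]
    rw [Finsupp.degree_eq_sum]
    constructor
    · rintro ⟨h1, h2⟩
      have ht : M.tp ∈ M.sD m := Finset.mem_insert_self _ _
      exact ⟨M.sD m, ⟨h1.1, ht⟩, (box_iff h1.1 ht m).2 ⟨rfl, h1⟩, h2⟩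
    · rintro ⟨D, ⟨h1, h2⟩, h3, h4⟩
      exact ⟨((box_iff h1 h2 m).1 h3).2, h4⟩
  · intro D hD D' hD' hne
    simp only [Finset.coe_filter, Finset.mem_univ, true_and, Set.mem_setOf_eq] at hD hD'
    simp only [Function.onFun]
    rw [Finset.disjoint_left]
    intro f hf hf'
    have h1 := (box_iff hD.1 hD.2 (Finsupp.equivFunOnFinite.symm f)).1 (by
      have := (Finset.mem_filter.1 hf).1
      simpa [box] using this)
    have h2 := (box_iff hD'.1 hD'.2 (Finsupp.equivFunOnFinite.symm f)).1 (by
      have := (Finset.mem_filter.1 hf').1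
      simpa [box] using this)
    exact hne (h1.1.symm.trans h2.1)

open Classical in
lemma exists_SU (r : ℕ) (hr : M.rk Finset.univ = r + 1) :
    ∃ a : ℤ → ℕ, SU r a ∧ ∀ k : ℕ, Module.finrank ℤ (M.chowComp k) = a k := by
  refine ⟨fun i : ℤ => ∑ D ∈ (Finset.univ : Finset (Finset (FlatVar M))).filter
      (fun D => M.IsCh D ∧ M.tp ∈ D),
      cz (∏ F, ∑ j ∈ Finset.Ico (M.lo D F) (M.lo D F + M.nn D F), Polynomial.X ^ j) i,
    ?_, fun k => (M.finrank_chowComp k).trans (card_FY k)⟩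
  apply SU.sum
  intro D hD
  obtain ⟨h1, h2⟩ := (Finset.mem_filter.1 hD).2
  have := SU_prod Finset.univ (M.lo D) (M.nn D)
  rw [center h1 h2, hr] at this
  simpa using this

end count

end SimpleFlatMatroid

open SimpleFlatMatroid in
/-- For every finite simple matroid `M` of rank `r+1`, the Hilbert function
`a_k = rank_ℤ A^k` of the Chow ring is symmetric and unimodal:
`a_k = a_{r-k}` for `0 ≤ k ≤ r`, and
`a₀ ≤ a₁ ≤ ⋯ ≤ a_{⌊r/2⌋} = a_{⌈r/2⌉} ≥ ⋯ ≥ a_{r-1} ≥ a_r`. -/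
theorem chow_hilbert_symmetric_unimodal {E : Type*} [Fintype E] [DecidableEq E]
    (M : SimpleFlatMatroid E) (r : ℕ) (hr : M.rk Finset.univ = r + 1) :
    (∀ k : ℕ, k ≤ r →
        Module.finrank ℤ (chowComp M k) = Module.finrank ℤ (chowComp M (r - k))) ∧
    (∀ k : ℕ, 2 * k < r →
        Module.finrank ℤ (chowComp M k) ≤ Module.finrank ℤ (chowComp M (k + 1))) ∧
    (Module.finrank ℤ (chowComp M (r / 2)) = Module.finrank ℤ (chowComp M ((r + 1) / 2))) ∧
    (∀ k : ℕ, r ≤ 2 * k → k < r →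
        Module.finrank ℤ (chowComp M (k + 1)) ≤ Module.finrank ℤ (chowComp M k)) := by
  have hne : Nonempty E := by
    by_contra h
    rw [not_nonempty_iff] at h
    rw [Finset.univ_eq_empty, M.rk_empty] at hr
    omega
  obtain ⟨a, ha, hk⟩ := exists_SU (M := M) r hr
  simp only [hk]
  have hsym : ∀ k : ℕ, k ≤ r → a k = a ((r - k : ℕ) : ℤ) := by
    intro k h
    rw [← ha.1 k]
    congr 1
    omega
  refine ⟨hsym, ?_, ?_, ?_⟩
  · intro k h
    have := ha.2 k (by omega)
    exact_mod_cast this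
  · rw [hsym (r / 2) (by omega)]
    congr 2
    omega
  · intro k h1 h2
    rw [hsym k (by omega), hsym (k + 1) (by omega)]
    have := ha.2 ((r - (k + 1) : ℕ) : ℤ) (by omega)
    rw [show (((r - (k + 1) : ℕ) : ℤ) + 1) = ((r - k : ℕ) : ℤ) by omega] at this
    exact this
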